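/- If there is a fixed integer r ≥ 2 such that the dimension d(e) of every edge e of the network N = (G, d, S, T) is a power of r, then the one-shot tensor-network capacity achieves the min-cut: R1(N) = MC(N). -/

import Mathlib

/-- A finite undirected multigraph without self-loops, together with disjoint
nonempty sets of source and sink vertices, in which every edge has at least
one internal endpoint (an internal vertex is one that is neither a source
nor a sink). Dimension functions on the edges are kept separate. -/
structure NetShape where
  V : Type
  E : Type
  [fintypeV : Fintype V]
  [fintypeE : Fintype E]
  [decEqV : DecidableEq V]
  [decEqE : DecidableEq E]
  /-- the two endpoints of each edge -/
  ends : E → V × V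
  no_loops : ∀ e, (ends e).1 ≠ (ends e).2
  /-- the set of source vertices -/
  S : Finset V
  /-- the set of sink vertices -/
  T : Finset V
  S_nonempty : S.Nonempty
  T_nonempty : T.Nonempty
  ST_disjoint : Disjoint S T
  /-- every edge has at least one internal endpoint -/
  edge_internal : ∀ e, ((ends e).1 ∉ S ∧ (ends e).1 ∉ T) ∨ ((ends e).2 ∉ S ∧ (ends e).2 ∉ T)

attribute [instance] NetShape.fintypeV NetShape.fintypeE NetShape.decEqV NetShape.decEqE

namespace NetShape

variable (G : NetShape)

/-- A vertex is internal if it is neither a source nor a sink. -/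
def Internal (v : G.V) : Prop := v ∉ G.S ∧ v ∉ G.T

instance : DecidablePred G.Internal := fun _ => instDecidableAnd

/-- `e` is incident to `v` if `v` is one of its endpoints. -/
def Incident (v : G.V) (e : G.E) : Prop := (G.ends e).1 = v ∨ (G.ends e).2 = v

instance (v : G.V) : DecidablePred (G.Incident v) := fun _ => instDecidableOr

/-- A source edge: one of its endpoints is a source. -/
def IsSourceEdge (e : G.E) : Prop := (G.ends e).1 ∈ G.S ∨ (G.ends e).2 ∈ G.S

/-- A sink edge: one of its endpoints is a sink. -/
def IsSinkEdge (e : G.E) : Prop := (G.ends e).1 ∈ G.T ∨ (G.ends e).2 ∈ G.T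

/-- An internal edge: both endpoints are internal, i.e. it is neither a source
edge nor a sink edge. -/
def IsInternalEdge (e : G.E) : Prop := ¬ G.IsSourceEdge e ∧ ¬ G.IsSinkEdge e

instance : DecidablePred G.IsSourceEdge := fun _ => instDecidableOr
instance : DecidablePred G.IsSinkEdge := fun _ => instDecidableOr
instance : DecidablePred G.IsInternalEdge := fun _ => instDecidableAnd

/-- A tensor assignment for the dimension function `d`: each internal vertex
`u` carries a tensor with one index of size `d e` for each edge `e` incident
to `u`. -/
def TensorAssignment (d : G.E → ℕ) : Type :=
  ∀ u : {v : G.V // G.Internal v},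
    ((e : {e : G.E // G.Incident u.1 e}) → Fin (d e.1)) → ℂ

/-- Combine index assignments on source, sink and internal edges into an index
assignment on all edges. -/
def fullIndex (d : G.E → ℕ)
    (a : (e : {e : G.E // G.IsSourceEdge e}) → Fin (d e.1))
    (b : (e : {e : G.E // G.IsSinkEdge e}) → Fin (d e.1))
    (c : (e : {e : G.E // G.IsInternalEdge e}) → Fin (d e.1))
    (e : G.E) : Fin (d e) :=
  if h : G.IsSourceEdge e then a ⟨e, h⟩
  else if h' : G.IsSinkEdge e then b ⟨e, h'⟩
  else c ⟨e, ⟨h, h'⟩⟩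

/-- The contraction of the tensor network: the matrix `β_𝒯`, with rows indexed
by the indices of the sink edges and columns by the indices of the source
edges, obtained by summing over all indices of the internal edges the product
over internal vertices of the corresponding tensor entries. -/
noncomputable def contraction (d : G.E → ℕ) (𝒯 : G.TensorAssignment d) :
    Matrix ((e : {e : G.E // G.IsSinkEdge e}) → Fin (d e.1))
           ((e : {e : G.E // G.IsSourceEdge e}) → Fin (d e.1)) ℂ :=
  fun b a =>
    ∑ c : (e : {e : G.E // G.IsInternalEdge e}) → Fin (d e.1),
      ∏ u : {v : G.V // G.Internal v},
        𝒯 u (fun e => G.fullIndex d a b c e.1)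

/-- The one-shot tensor-network capacity: the maximal rank of the contraction
over all tensor assignments. -/
noncomputable def R1 (d : G.E → ℕ) : ℕ :=
  sSup { r | ∃ 𝒯 : G.TensorAssignment d, (G.contraction d 𝒯).rank = r }

/-- A cut, given by the source side `A`: it contains all sources and no sinks
(the sink side is the complement of `A`). -/
def IsCut (A : Finset G.V) : Prop := G.S ⊆ A ∧ ∀ v ∈ G.T, v ∉ A

/-- An edge crosses the cut with source side `A` if exactly one of its
endpoints lies in `A`. -/
def Crosses (A : Finset G.V) (e : G.E) : Prop :=
  ((G.ends e).1 ∈ A ∧ (G.ends e).2 ∉ A) ∨ ((G.ends e).1 ∉ A ∧ (G.ends e).2 ∈ A)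

instance (A : Finset G.V) : DecidablePred (G.Crosses A) := fun _ => instDecidableOr

/-- The value of a cut: the product of the dimensions of the crossing edges. -/
def cutValue (d : G.E → ℕ) (A : Finset G.V) : ℕ :=
  ∏ e ∈ Finset.univ.filter (G.Crosses A), d e

/-- The min-cut: the minimum cut value over all cuts. -/
noncomputable def MC (d : G.E → ℕ) : ℕ :=
  sInf { w | ∃ A : Finset G.V, G.IsCut A ∧ G.cutValue d A = w }

end NetShape

/-- If every set `X` of vertices avoiding `B` satisfies `|X| + K ≤ |N(X) ∪ A|`, then there are
`K` vertices of `A` joined to `B` by pairwise disjoint walks; the walk starting at `a`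
consists of vertices with label `a`. -/
theorem exists_disjoint_walks {α : Type*} [Fintype α] [DecidableEq α]
    (R : α → α → Prop) (A B : Finset α) (K : ℕ)
    (hK : ∀ X Y : Finset α, Disjoint X B → (∀ u ∈ X, ∀ v, R u v → v ∈ Y) → A ⊆ Y →
      X.card + K ≤ Y.card) :
    ∃ (A' : Finset α) (ℓ : α → α), A' ⊆ A ∧ K ≤ A'.card ∧
      ∀ a ∈ A', ℓ a = a ∧
        ∃ b ∈ B, Relation.ReflTransGen (fun u v => R u v ∧ ℓ u = ℓ v) a b := by
  classical
  have hKA : K ≤ A.card := by simpa using hK ∅ A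
  -- Hall's theorem, with `|A| - K` dummy elements
  let N : {v // v ∉ B} → Finset (α ⊕ Fin (A.card - K)) := fun u =>
    (Finset.univ.filter (fun v => R u v ∧ v ∉ A)).disjSum Finset.univ
  obtain ⟨f, hf, hfN⟩ := (Finset.all_card_le_biUnion_card_iff_exists_injective N).1 (by
    intro X
    rcases X.eq_empty_or_nonempty with rfl | ⟨x, hx⟩
    · simp
    let X' : Finset α := X.map (Function.Embedding.subtype _)
    have h1 : Disjoint X' B := by
      rw [Finset.disjoint_left]
      intro v hv
      simp only [X', Finset.mem_map, Function.Embedding.coe_subtype] at hv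
      obtain ⟨u, -, rfl⟩ := hv
      exact u.2
    have h2 : X'.card = X.card := Finset.card_map _
    let Y : Finset α := Finset.univ.filter (fun v => (∃ u ∈ X', R u v) ∧ v ∉ A)
    have h3 := hK X' (Y ∪ A) h1 (fun u hu v huv => by
      by_cases hv : v ∈ A
      · exact Finset.mem_union_right _ hv
      · exact Finset.mem_union_left _
          (Finset.mem_filter.2 ⟨Finset.mem_univ _, ⟨u, hu, huv⟩, hv⟩))
      Finset.subset_union_right
    have h4 : Y.disjSum (Finset.univ : Finset (Fin (A.card - K))) ⊆ X.biUnion N := by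
      intro w hw
      rw [Finset.mem_biUnion]
      rcases w with v | i
      · simp only [Y, X', Finset.inl_mem_disjSum, Finset.mem_filter, Finset.mem_univ, true_and,
          Finset.mem_map, Function.Embedding.coe_subtype] at hw
        obtain ⟨⟨_, ⟨u, hu, rfl⟩, huv⟩, hvA⟩ := hw
        exact ⟨u, hu, by simpa [N] using ⟨huv, hvA⟩⟩
      · exact ⟨x, hx, by simp [N]⟩
    have h5 := Finset.card_le_card h4
    rw [Finset.card_disjSum, Finset.card_univ, Fintype.card_fin] at h5
    have h6 := Finset.card_union_le Y A
    omega)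
  let step : α → α → Prop := fun u v => ∃ h : u ∉ B, f ⟨u, h⟩ = Sum.inl v
  have step_spec : ∀ u v, step u v → R u v ∧ v ∉ A := by
    rintro u v ⟨h, huv⟩
    have := hfN ⟨u, h⟩
    rw [huv] at this
    simpa [N] using this
  have step_inj : ∀ u u' v, step u v → step u' v → u = u' := by
    rintro u u' v ⟨h, e⟩ ⟨h', e'⟩
    exact congrArg Subtype.val (hf (e.trans e'.symm))
  have reach_unique : ∀ a ∈ A, ∀ a' ∈ A, ∀ v, Relation.ReflTransGen step a v →
      Relation.ReflTransGen step a' v → a = a' := by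
    intro a ha a' ha' v h h'
    induction h with
    | refl =>
      rcases Relation.ReflTransGen.cases_tail h' with h | ⟨u, -, hu⟩
      · exact h
      · exact absurd ha (step_spec _ _ hu).2
    | tail _ huv ih =>
      rcases Relation.ReflTransGen.cases_tail h' with h | ⟨u, hu, hu'⟩
      · exact absurd (h ▸ ha') (step_spec _ _ huv).2
      · exact ih (step_inj _ _ _ hu' huv ▸ hu)
  have terminates : ∀ a ∈ A, (∃ b ∈ B, Relation.ReflTransGen step a b) ∨
      ∃ (i : Fin (A.card - K)) (u : {v // v ∉ B}),
        Relation.ReflTransGen step a u ∧ f u = Sum.inr i := by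
    intro a ha
    by_contra! hcon
    obtain ⟨hB, hD⟩ := hcon
    have hnext : ∀ x : {v // Relation.ReflTransGen step a v},
        ∃ y : {v // Relation.ReflTransGen step a v}, step x y := by
      rintro ⟨x, hx⟩
      have hxB : x ∉ B := fun h => hB x h hx
      rcases hfx : f ⟨x, hxB⟩ with v | i
      · exact ⟨⟨v, hx.tail ⟨hxB, hfx⟩⟩, hxB, hfx⟩
      · exact absurd hfx (hD i ⟨x, hxB⟩ hx)
    choose g hg using hnext
    have hginj : Function.Injective g := fun x y hxy =>
      Subtype.ext (step_inj _ _ _ (hg x) (hxy ▸ hg y))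
    obtain ⟨x, hx⟩ := Finite.surjective_of_injective hginj ⟨a, .refl⟩
    have := hg x
    rw [hx] at this
    exact (step_spec _ _ this).2 ha
  let A' := A.filter (fun a => ∃ b ∈ B, Relation.ReflTransGen step a b)
  let ℓ : α → α := fun v =>
    if h : ∃ a ∈ A, Relation.ReflTransGen step a v then h.choose else v
  have label_eq : ∀ a ∈ A, ∀ v, Relation.ReflTransGen step a v → ℓ v = a := by
    intro a ha v hv
    have h : ∃ a ∈ A, Relation.ReflTransGen step a v := ⟨a, ha, hv⟩
    simp only [ℓ, dif_pos h]
    exact reach_unique _ h.choose_spec.1 a ha v h.choose_spec.2 hv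
  refine ⟨A', ℓ, Finset.filter_subset _ _, ?_, ?_⟩
  · have hbad : (A.filter (fun a => ¬ ∃ b ∈ B, Relation.ReflTransGen step a b)).card
        ≤ A.card - K := by
      have h : ∀ a : {a // a ∈ A.filter (fun a => ¬ ∃ b ∈ B, Relation.ReflTransGen step a b)},
          ∃ (i : Fin (A.card - K)) (u : {v // v ∉ B}),
            Relation.ReflTransGen step a u ∧ f u = Sum.inr i := by
        rintro ⟨a, ha⟩
        rw [Finset.mem_filter] at ha
        exact (terminates a ha.1).resolve_left ha.2
      choose i u hu hi using h
      have hinj : Function.Injective i := by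
        intro a a' haa
        have huu : u a = u a' := hf (by rw [hi, hi, haa])
        exact Subtype.ext (reach_unique _ (Finset.mem_filter.1 a.2).1 _
          (Finset.mem_filter.1 a'.2).1 _ (hu a) (huu ▸ hu a'))
      have := Fintype.card_le_of_injective i hinj
      rwa [Fintype.card_coe, Fintype.card_fin] at this
    have := Finset.card_filter_add_card_filter_not (s := A)
      (fun a => ∃ b ∈ B, Relation.ReflTransGen step a b)
    change K ≤ (A.filter _).card
    omega
  · intro a ha
    obtain ⟨haA, b, hb, hab⟩ := Finset.mem_filter.1 ha
    refine ⟨label_eq a haA a .refl, b, hb, ?_⟩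
    clear hb ha
    induction hab with
    | refl => exact .refl
    | tail hau huv ih =>
      exact ih.tail ⟨(step_spec _ _ huv).1,
        (label_eq a haA _ hau).trans (label_eq a haA _ (hau.tail huv)).symm⟩

/-- A matrix whose entries are sums over index assignments of a product of two factors, one
depending only on the coordinates in `X` or `p` and the other only on the coordinates in `X` or
not in `p`, has rank at most the number of index assignments on `X`. -/
theorem rank_le_prod_card_of_split {E m n : Type*} [Fintype E] [DecidableEq E] [Fintype m]
    [Fintype n] (D : E → Type*) [∀ e, Fintype (D e)] [∀ e, Nonempty (D e)]
    (X p : E → Prop) [DecidablePred X] [DecidablePred p]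
    (F : n → (∀ e, D e) → ℂ) (H : m → (∀ e, D e) → ℂ)
    (hF : ∀ a i j, (∀ e, X e ∨ p e → i e = j e) → F a i = F a j)
    (hH : ∀ b i j, (∀ e, X e ∨ ¬ p e → i e = j e) → H b i = H b j) :
    (Matrix.of fun b a => ∑ i, F a i * H b i).rank
      ≤ ∏ e ∈ Finset.univ.filter X, Fintype.card (D e) := by
  classical
  let φ := (Equiv.piEquivPiSubtypeProd X D).trans
    ((Equiv.refl _).prodCongr
      (Equiv.piEquivPiSubtypeProd (fun e : {e // ¬ X e} => p e) (fun e => D e)))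
  let z₀ : ∀ e : {e : {e // ¬ X e} // ¬ p e}, D e := fun _ => Classical.arbitrary _
  let y₀ : ∀ e : {e : {e // ¬ X e} // p e}, D e := fun _ => Classical.arbitrary _
  let P : Matrix m (∀ e : {e // X e}, D e) ℂ :=
    Matrix.of fun b x => ∑ z, H b (φ.symm (x, y₀, z))
  let Q : Matrix (∀ e : {e // X e}, D e) n ℂ :=
    Matrix.of fun x a => ∑ y, F a (φ.symm (x, y, z₀))
  have hmul : (Matrix.of fun b a => ∑ i, F a i * H b i) = P * Q := by
    ext b a
    simp only [Matrix.of_apply, Matrix.mul_apply, P, Q]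
    rw [← φ.symm.sum_comp, Fintype.sum_prod_type]
    refine Finset.sum_congr rfl fun x _ => ?_
    rw [Fintype.sum_prod_type, mul_comm, Finset.sum_mul_sum]
    refine Finset.sum_congr rfl fun y _ => Finset.sum_congr rfl fun z _ => ?_
    congr 1
    · refine hF _ _ _ fun e he => ?_
      simp only [φ, Equiv.symm_trans_apply, Equiv.prodCongr_symm, Equiv.prodCongr_apply,
        Equiv.piEquivPiSubtypeProd, Equiv.coe_fn_symm_mk, Prod.map, Equiv.refl_symm, Equiv.refl_apply]
      by_cases hX : X e
      · simp [hX]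
      · simp [hX, he.resolve_left hX]
    · refine hH _ _ _ fun e he => ?_
      simp only [φ, Equiv.symm_trans_apply, Equiv.prodCongr_symm, Equiv.prodCongr_apply,
        Equiv.piEquivPiSubtypeProd, Equiv.coe_fn_symm_mk, Prod.map, Equiv.refl_symm, Equiv.refl_apply]
      by_cases hX : X e
      · simp [hX]
      · simp [hX, he.resolve_left hX]
  rw [hmul]
  refine (Matrix.rank_mul_le_left P Q).trans ((Matrix.rank_le_card_width P).trans_eq ?_)
  rw [Fintype.card_pi]
  exact (Finset.prod_subtype (Finset.univ.filter X) (fun e => by simp)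
    fun e => Fintype.card (D e)).symm

namespace NetShape

variable (G : NetShape)

theorem exists_end_of_incident {v : G.V} {e : G.E} (h : G.Incident v e) {p : G.V → Prop}
    (hv : p v) : p (G.ends e).1 ∨ p (G.ends e).2 := by
  rcases h with h | h
  · exact Or.inl (h.symm ▸ hv)
  · exact Or.inr (h.symm ▸ hv)

theorem not_isSinkEdge_of_isSourceEdge {e : G.E} (h : G.IsSourceEdge e) : ¬ G.IsSinkEdge e := by
  intro h'
  have hST := Finset.disjoint_left.1 G.ST_disjoint
  have := G.edge_internal e
  unfold IsSourceEdge at h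
  unfold IsSinkEdge at h'
  have h1 := @hST (G.ends e).1
  have h2 := @hST (G.ends e).2
  tauto

theorem isCut_S : G.IsCut G.S :=
  ⟨subset_rfl, fun _ hv => Finset.disjoint_right.1 G.ST_disjoint hv⟩

/-- The contraction as a sum over index assignments on all edges. -/
theorem contraction_eq_sum (d : G.E → ℕ) (𝒯 : G.TensorAssignment d)
    (b : (e : {e : G.E // G.IsSinkEdge e}) → Fin (d e.1))
    (a : (e : {e : G.E // G.IsSourceEdge e}) → Fin (d e.1)) :
    G.contraction d 𝒯 b a = ∑ i : (∀ e, Fin (d e)),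
      if (∀ e : {e : G.E // G.IsSourceEdge e}, i e = a e) ∧
          (∀ e : {e : G.E // G.IsSinkEdge e}, i e = b e)
        then ∏ u, 𝒯 u (fun e => i e.1) else 0 := by
  rw [← Finset.sum_filter]
  refine Finset.sum_bij' (fun c _ => G.fullIndex d a b c) (fun i _ e => i e.1) ?_ ?_ ?_ ?_ ?_
  · intro c _
    rw [Finset.mem_filter]
    refine ⟨Finset.mem_univ _, fun e => ?_, fun e => ?_⟩
    · simp [fullIndex, e.2]
    · have : ¬ G.IsSourceEdge e := fun h => G.not_isSinkEdge_of_isSourceEdge h e.2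
      simp [fullIndex, e.2, this]
  · simp
  · intro c _
    funext e
    simp [fullIndex, e.2.1, e.2.2]
  · intro i hi
    rw [Finset.mem_filter] at hi
    funext e
    unfold fullIndex
    split_ifs with h h'
    · exact (hi.2.1 ⟨e, h⟩).symm
    · exact (hi.2.2 ⟨e, h'⟩).symm
    · rfl
  · intro c _
    rfl

theorem rank_contraction_le_cutValue (d : G.E → ℕ) (hd : ∀ e, 2 ≤ d e)
    (𝒯 : G.TensorAssignment d) (A : Finset G.V) (hA : G.IsCut A) :
    (G.contraction d 𝒯).rank ≤ G.cutValue d A := by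
  classical
  have : ∀ e, Nonempty (Fin (d e)) := fun e => ⟨⟨0, by have := hd e; omega⟩⟩
  let F : ((e : {e : G.E // G.IsSourceEdge e}) → Fin (d e.1)) → (∀ e, Fin (d e)) → ℂ :=
    fun a i => if ∀ e : {e : G.E // G.IsSourceEdge e}, i e = a e then
      ∏ u with u.1 ∈ A, 𝒯 u (fun e => i e.1) else 0
  let H : ((e : {e : G.E // G.IsSinkEdge e}) → Fin (d e.1)) → (∀ e, Fin (d e)) → ℂ :=
    fun b i => if ∀ e : {e : G.E // G.IsSinkEdge e}, i e = b e then
      ∏ u with u.1 ∉ A, 𝒯 u (fun e => i e.1) else 0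
  have key : G.contraction d 𝒯 = Matrix.of fun b a => ∑ i, F a i * H b i := by
    ext b a
    rw [contraction_eq_sum, Matrix.of_apply]
    refine Finset.sum_congr rfl fun i _ => ?_
    simp only [F, H]
    rw [ite_zero_mul_ite_zero, Finset.prod_filter_mul_prod_filter_not]
  rw [key]
  have hsplit := rank_le_prod_card_of_split (fun e => Fin (d e)) (G.Crosses A)
    (fun e => (G.ends e).1 ∈ A) F H ?_ ?_
  · simpa [cutValue] using hsplit
  · intro a i j hij
    have hmeet : ∀ e, (G.ends e).1 ∈ A ∨ (G.ends e).2 ∈ A → i e = j e := by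
      intro e he
      refine hij e ?_
      unfold Crosses
      tauto
    have h1 : ∀ e : {e : G.E // G.IsSourceEdge e}, i e = j e := fun e =>
      hmeet e (e.2.imp (fun h => hA.1 h) (fun h => hA.1 h))
    simp only [F, h1]
    congr 1
    refine Finset.prod_congr rfl fun u hu => ?_
    congr 1
    funext e
    have hu := (Finset.mem_filter.1 hu).2
    exact hmeet e (G.exists_end_of_incident e.2 (p := (· ∈ A)) hu)
  · intro b i j hij
    have hmeet : ∀ e, (G.ends e).1 ∉ A ∨ (G.ends e).2 ∉ A → i e = j e := by
      intro e he
      refine hij e ?_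
      unfold Crosses
      tauto
    have h1 : ∀ e : {e : G.E // G.IsSinkEdge e}, i e = j e := fun e =>
      hmeet e (e.2.imp (fun h => hA.2 _ h) (fun h => hA.2 _ h))
    simp only [H, h1]
    congr 1
    refine Finset.prod_congr rfl fun u hu => ?_
    congr 1
    funext e
    have hu := (Finset.mem_filter.1 hu).2
    exact hmeet e (G.exists_end_of_incident e.2 (p := (· ∉ A)) hu)

/-- The set of edges with each edge `e` replaced by `k e` parallel copies. -/
abbrev EdgeCopy (k : G.E → ℕ) : Type := Σ e : G.E, Fin (k e)

/-- Two edge copies are adjacent if they share an internal vertex. -/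
def CopyAdj (k : G.E → ℕ) (x y : G.EdgeCopy k) : Prop :=
  ∃ u, G.Internal u ∧ G.Incident u x.1 ∧ G.Incident u y.1

/-- If every cut is crossed by at least `K` edge copies, then `K` disjoint walks of edge copies
lead from source edges to sink edges. -/
theorem exists_disjoint_edgeCopy_walks (k : G.E → ℕ) (K : ℕ)
    (hK : ∀ A, G.IsCut A → K ≤ ∑ e ∈ Finset.univ.filter (G.Crosses A), k e) :
    ∃ (A' : Finset (G.EdgeCopy k)) (ℓ : G.EdgeCopy k → G.EdgeCopy k), K ≤ A'.card ∧
      ∀ a ∈ A', G.IsSourceEdge a.1 ∧ ℓ a = a ∧ ∃ b, G.IsSinkEdge b.1 ∧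
        Relation.ReflTransGen (fun x y => G.CopyAdj k x y ∧ ℓ x = ℓ y) a b := by
  classical
  obtain ⟨A', ℓ, hA', hcard, hpath⟩ := exists_disjoint_walks (G.CopyAdj k)
    (Finset.univ.filter fun x => G.IsSourceEdge x.1)
    (Finset.univ.filter fun x => G.IsSinkEdge x.1) K (by
    intro X Y hX hXY hSY
    let C : Finset G.V :=
      Finset.univ.filter fun v => v ∈ G.S ∨ (G.Internal v ∧ ∃ x ∈ X, G.Incident v x.1)
    have memC : ∀ v, v ∈ C ↔ v ∈ G.S ∨ (G.Internal v ∧ ∃ x ∈ X, G.Incident v x.1) := by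
      simp [C]
    have hC : G.IsCut C := by
      refine ⟨fun v hv => (memC v).2 (Or.inl hv), fun v hv h => ?_⟩
      rcases (memC v).1 h with h | h
      · exact Finset.disjoint_left.1 G.ST_disjoint h hv
      · exact h.1.2 hv
    have hZ : ∑ e ∈ Finset.univ.filter (G.Crosses C), k e
        = ((Finset.univ.filter (G.Crosses C)).sigma
            fun e => (Finset.univ : Finset (Fin (k e)))).card := by
      simp
    have hcross : ∀ x : G.EdgeCopy k, ∀ v w, v ∈ C → w ∉ C → G.Incident v x.1 →
        G.Incident w x.1 → (G.Internal v ∨ G.Internal w) →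
        x ∉ X ∧ ((∃ u ∈ X, G.CopyAdj k u x) ∨ G.IsSourceEdge x.1) := by
      intro x v w hv hw hvx hwx hvw
      rw [memC] at hv hw
      push Not at hw
      have hxX : x ∉ X := by
        intro hx
        have hwI : ¬ G.Internal w := fun h => hw.2 h x hx hwx
        have hwT : w ∈ G.T := by
          by_contra h
          exact hwI ⟨hw.1, h⟩
        refine Finset.disjoint_left.1 hX hx ?_
        rw [Finset.mem_filter]
        refine ⟨Finset.mem_univ _, ?_⟩
        exact G.exists_end_of_incident hwx (p := (· ∈ G.T)) hwT
      refine ⟨hxX, ?_⟩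
      rcases hv with hv | ⟨hvI, y, hy, hvy⟩
      · exact Or.inr (G.exists_end_of_incident hvx (p := (· ∈ G.S)) hv)
      · exact Or.inl ⟨y, hy, v, hvI, hvy, hvx⟩
    have hsub : ((Finset.univ.filter (G.Crosses C)).sigma
          fun e => (Finset.univ : Finset (Fin (k e)))) ∪ X ⊆ Y := by
      intro x hx
      suffices h : (∃ u ∈ X, G.CopyAdj k u x) ∨ G.IsSourceEdge x.1 by
        rcases h with ⟨u, hu, hux⟩ | h
        · exact hXY u hu x hux
        · exact hSY (Finset.mem_filter.2 ⟨Finset.mem_univ _, h⟩)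
      simp only [Finset.mem_union, Finset.mem_sigma, Finset.mem_filter, Finset.mem_univ,
        true_and, and_true] at hx
      rcases hx with hx | hx
      · rcases hx with ⟨h1, h2⟩ | ⟨h1, h2⟩
        · exact (hcross x _ _ h1 h2 (Or.inl rfl) (Or.inr rfl) (G.edge_internal x.1)).2
        · exact (hcross x _ _ h2 h1 (Or.inr rfl) (Or.inl rfl) (G.edge_internal x.1).symm).2
      · refine Or.inl ⟨x, hx, ?_⟩
        rcases G.edge_internal x.1 with h | h
        · exact ⟨_, h, Or.inl rfl, Or.inl rfl⟩
        · exact ⟨_, h, Or.inr rfl, Or.inr rfl⟩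
    have hdisj : Disjoint ((Finset.univ.filter (G.Crosses C)).sigma
          fun e => (Finset.univ : Finset (Fin (k e)))) X := by
      rw [Finset.disjoint_left]
      intro x hx
      simp only [Finset.mem_sigma, Finset.mem_filter, Finset.mem_univ, true_and, and_true] at hx
      rcases hx with ⟨h1, h2⟩ | ⟨h1, h2⟩
      · exact (hcross x _ _ h1 h2 (Or.inl rfl) (Or.inr rfl) (G.edge_internal x.1)).1
      · exact (hcross x _ _ h2 h1 (Or.inr rfl) (Or.inl rfl) (G.edge_internal x.1).symm).1
    have h1 := Finset.card_le_card hsub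
    rw [Finset.card_union_of_disjoint hdisj, ← hZ] at h1
    have h2 := hK C hC
    omega)
  refine ⟨A', ℓ, hcard, fun a ha => ⟨(Finset.mem_filter.1 (hA' ha)).2, (hpath a ha).1, ?_⟩⟩
  obtain ⟨b, hb, hab⟩ := (hpath a ha).2
  exact ⟨b, (Finset.mem_filter.1 hb).2, hab⟩

/-- Routing along `K` disjoint walks of edge copies gives a contraction of rank at least
`r ^ K`. -/
theorem exists_pow_le_rank_contraction (d : G.E → ℕ) (r : ℕ) (hr : 2 ≤ r) (k : G.E → ℕ)
    (hk : ∀ e, d e = r ^ k e) (K : ℕ)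
    (hK : ∀ A, G.IsCut A → K ≤ ∑ e ∈ Finset.univ.filter (G.Crosses A), k e) :
    ∃ 𝒯 : G.TensorAssignment d, r ^ K ≤ (G.contraction d 𝒯).rank := by
  classical
  obtain ⟨A', ℓ, hcard, hpath⟩ := G.exists_disjoint_edgeCopy_walks k K hK
  let φ : ∀ e, Fin (d e) ≃ (Fin (k e) → Fin r) := fun e =>
    (finCongr (hk e)).trans finFunctionFinEquiv.symm
  let P : ∀ u : {v : G.V // G.Internal v},
      ((e : {e : G.E // G.Incident u.1 e}) → Fin (d e.1)) → Prop := fun u i =>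
    ∃ w : G.EdgeCopy k → Fin r, ∀ (e : {e : G.E // G.Incident u.1 e}) (t : Fin (k e)),
      φ e (i e) t = w (ℓ ⟨e, t⟩)
  let 𝒯 : G.TensorAssignment d := fun u i => if P u i then 1 else 0
  let w : (A' → Fin r) → G.EdgeCopy k → Fin r := fun y x =>
    if h : x ∈ A' then y ⟨x, h⟩ else ⟨0, by omega⟩
  let idx : (A' → Fin r) → ∀ e, Fin (d e) := fun y e =>
    (φ e).symm fun t => w y (ℓ ⟨e, t⟩)
  let n : (A' → Fin r) → ℕ := fun y =>
    (Finset.univ.filter fun c => ∀ u : {v : G.V // G.Internal v},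
      P u (fun e => G.fullIndex d (fun e => idx y e) (fun e => idx y e) c e)).card
  have entry : ∀ b a, G.contraction d 𝒯 b a = ((Finset.univ.filter fun c =>
      ∀ u : {v : G.V // G.Internal v}, P u (fun e => G.fullIndex d a b c e)).card : ℂ) := by
    intro b a
    rw [← Finset.sum_boole]
    refine Finset.sum_congr rfl fun c _ => ?_
    rw [← Fintype.prod_boole]
  have diag : (G.contraction d 𝒯).submatrix
      (fun y : A' → Fin r => fun e => idx y e) (fun y : A' → Fin r => fun e => idx y e)
      = Matrix.diagonal fun y => (n y : ℂ) := by
    ext y z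
    rw [Matrix.submatrix_apply, entry]
    by_cases hyz : y = z
    · subst hyz
      rw [Matrix.diagonal_apply_eq]
    rw [Matrix.diagonal_apply_ne _ hyz, Nat.cast_eq_zero, Finset.card_eq_zero,
      Finset.filter_eq_empty_iff]
    intro c _ hc
    refine hyz (funext fun a => ?_)
    let i := G.fullIndex d (fun e => idx z e) (fun e => idx y e) c
    obtain ⟨hsrc, hℓ, b, hsink, hab⟩ := hpath a a.2
    have hconst : φ _ (i a.1.1) a.1.2 = φ _ (i b.1) b.2 ∧ ℓ a = ℓ b := by
      clear hsink
      induction hab with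
      | refl => exact ⟨rfl, rfl⟩
      | @tail x x' _ hxx ih =>
        obtain ⟨⟨u, hu, hx, hx'⟩, hl⟩ := hxx
        obtain ⟨w', hw'⟩ := hc ⟨u, hu⟩
        refine ⟨ih.1.trans ?_, ih.2.trans hl⟩
        exact (hw' ⟨x.1, hx⟩ x.2).trans ((congrArg w' hl).trans (hw' ⟨x'.1, hx'⟩ x'.2).symm)
    have h1 : i a.1.1 = idx z a.1.1 := by
      simp [i, fullIndex, hsrc]
    have h2 : i b.1 = idx y b.1 := by
      have : ¬ G.IsSourceEdge b.1 := fun h => G.not_isSinkEdge_of_isSourceEdge h hsink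
      simp [i, fullIndex, hsink, this]
    have h3 := hconst.1
    rw [h1, h2] at h3
    simp only [idx, Equiv.apply_symm_apply] at h3
    rw [← hconst.2, hℓ] at h3
    simpa [w] using h3.symm
  have hn : ∀ y, n y ≠ 0 := by
    intro y
    refine Finset.card_ne_zero.2 ⟨fun e => idx y e, ?_⟩
    rw [Finset.mem_filter]
    refine ⟨Finset.mem_univ _, fun u => ⟨w y, fun e t => ?_⟩⟩
    have : G.fullIndex d (fun e => idx y e) (fun e => idx y e) (fun e => idx y e) e.1
        = idx y e.1 := by
      unfold fullIndex
      split_ifs <;> rfl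
    simp only [this]
    simp [idx]
  refine ⟨𝒯, ?_⟩
  calc r ^ K ≤ r ^ A'.card := Nat.pow_le_pow_right (by omega) hcard
    _ = (Matrix.diagonal fun y => (n y : ℂ)).rank := by
      rw [Matrix.rank_diagonal]
      simp [hn]
    _ ≤ (G.contraction d 𝒯).rank := by
      rw [← diag]
      exact Matrix.rank_submatrix_le _ _ _

end NetShape

/-- if every edge dimension is a power of a fixed integer
`r ≥ 2`, then the one-shot tensor-network capacity achieves the min-cut. -/
theorem stmt3 (G : NetShape) (d : G.E → ℕ) (hd : ∀ e, 2 ≤ d e)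
    (r : ℕ) (hr : 2 ≤ r) (hpow : ∀ e, ∃ k : ℕ, d e = r ^ k) :
    G.R1 d = G.MC d := by
  obtain ⟨C, hC, hCval⟩ :=
    Nat.sInf_mem (s := {w | ∃ A : Finset G.V, G.IsCut A ∧ G.cutValue d A = w})
      ⟨_, G.S, G.isCut_S, rfl⟩
  have hle : ∀ 𝒯 : G.TensorAssignment d, (G.contraction d 𝒯).rank ≤ G.MC d := fun 𝒯 =>
    (G.rank_contraction_le_cutValue d hd 𝒯 C hC).trans_eq hCval
  choose k hk using hpow
  have hval : ∀ A, G.cutValue d A = r ^ ∑ e ∈ Finset.univ.filter (G.Crosses A), k e := by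
    intro A
    simp only [NetShape.cutValue, hk, Finset.prod_pow_eq_pow_sum]
  obtain ⟨𝒯, h𝒯⟩ := G.exists_pow_le_rank_contraction d r hr k hk
    (∑ e ∈ Finset.univ.filter (G.Crosses C), k e) (by
      intro A hA
      rw [← Nat.pow_le_pow_iff_right (show 1 < r by omega), ← hval, ← hval, hCval]
      exact Nat.sInf_le ⟨A, hA, rfl⟩)
  rw [← hval, hCval] at h𝒯
  refine le_antisymm (csSup_le ⟨_, 𝒯, rfl⟩ ?_) (h𝒯.trans (le_csSup ⟨G.MC d, ?_⟩ ⟨𝒯, rfl⟩))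
  · rintro _ ⟨𝒯', rfl⟩
    exact hle 𝒯'
  · rintro _ ⟨𝒯', rfl⟩
    exact hle 𝒯'
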